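/- arXiv:1303.2671 — 2 statements merged into one kernel-verified Lean document; each statement's English description precedes it below -/
import Mathlib

section
/- Let Λ = (λ_1,…,λ_n), λ_i ∈ ℝ^k, be weakly hyperbolic, let Λ' = (λ_1, λ_1, λ_2, …, λ_n), and write Z' = Z(Λ') ⊆ ℝ^{n+1} with coordinates (x_0, x_1, …, x_n). Set Z_+ = Z(Λ) ∩ {x_1 ≥ 0} and Z'_+ = Z' ∩ {x_0 ≥ 0}. Then the inclusion ι : Z_+ → Z'_+, ι(x_1,…,x_n) = (0, x_1, …, x_n), is a homotopy equivalence of topological spaces (with the subspace topologies); a homotopy inverse is the retraction (x_0, x_1, x_2, …, x_n) ↦ (√(x_0² + x_1²), x_2, …, x_n). -/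
open scoped BigOperators

/-- The intersection of quadrics `Z(Λ)` for a configuration `Λ` of vectors in `ℝ^k`. -/
def ZReal {n k : ℕ} (Λ : Fin n → Fin k → ℝ) : Set (Fin n → ℝ) :=
  {x | (∑ i, (x i) ^ 2 • Λ i) = 0 ∧ (∑ i, (x i) ^ 2) = 1}

/-- `Λ` is weakly hyperbolic. -/
def WeaklyHyperbolic {n k : ℕ} (Λ : Fin n → Fin k → ℝ) : Prop :=
  ∀ J : Finset (Fin n), J.card ≤ k → (0 : Fin k → ℝ) ∉ convexHull ℝ (Λ '' ↑J)

/-- `Λ' = (λ_1, λ_1, λ_2, …, λ_n)`: the configuration with `λ_1` repeated. -/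
def doubled {n k : ℕ} (Λ : Fin (n + 1) → Fin k → ℝ) : Fin (n + 2) → Fin k → ℝ :=
  Fin.cons (Λ 0) Λ

/-- The half manifold `Z_+ = Z(Λ) ∩ {x_1 ≥ 0}`. -/
def ZPlus {n k : ℕ} (Λ : Fin (n + 1) → Fin k → ℝ) : Set (Fin (n + 1) → ℝ) :=
  {x | x ∈ ZReal Λ ∧ 0 ≤ x 0}

/-- The half manifold `Z'_+ = Z' ∩ {x_0 ≥ 0}` (coordinates `(x_0, x_1, …, x_n)`). -/
def ZPlus' {n k : ℕ} (Λ : Fin (n + 1) → Fin k → ℝ) : Set (Fin (n + 2) → ℝ) :=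
  {x | x ∈ ZReal (doubled Λ) ∧ 0 ≤ x 0}

/-- The retraction `(x_0, x_1, x_2, …, x_n) ↦ (√(x_0² + x_1²), x_2, …, x_n)`. -/
noncomputable def retractMap {n : ℕ} (x : Fin (n + 2) → ℝ) : Fin (n + 1) → ℝ :=
  fun i => if i = 0 then Real.sqrt (x 0 ^ 2 + x 1 ^ 2) else x i.succ

theorem mem_ZReal_doubled_iff {n k : ℕ} (Λ : Fin (n + 1) → Fin k → ℝ) (x : Fin (n + 2) → ℝ) :
    x ∈ ZReal (doubled Λ) ↔ retractMap x ∈ ZReal Λ := by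
  have h : √(x 0 ^ 2 + x 1 ^ 2) ^ 2 = x 0 ^ 2 + x 1 ^ 2 := Real.sq_sqrt (by positivity)
  simp [ZReal, retractMap, doubled, Fin.sum_univ_succ, h, add_smul, add_assoc]

theorem retractMap_zero {n : ℕ} (x : Fin (n + 2) → ℝ) :
    retractMap x 0 = √(x 0 ^ 2 + x 1 ^ 2) := if_pos rfl

theorem retractMap_mem_ZPlus {n k : ℕ} {Λ : Fin (n + 1) → Fin k → ℝ} {x : Fin (n + 2) → ℝ}
    (hx : x ∈ ZPlus' Λ) : retractMap x ∈ ZPlus Λ :=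
  ⟨(mem_ZReal_doubled_iff Λ x).1 hx.1, by rw [retractMap_zero]; positivity⟩

theorem retractMap_cons_zero {n : ℕ} {p : Fin (n + 1) → ℝ} (hp : 0 ≤ p 0) :
    retractMap (Fin.cons 0 p : Fin (n + 2) → ℝ) = p := by
  ext i
  by_cases hi : i = 0
  · subst hi
    simp [retractMap, Real.sqrt_sq hp]
  · simp [retractMap, hi]

theorem cons_zero_mem_ZPlus' {n k : ℕ} {Λ : Fin (n + 1) → Fin k → ℝ} {p : Fin (n + 1) → ℝ}
    (hp : p ∈ ZPlus Λ) : (Fin.cons 0 p : Fin (n + 2) → ℝ) ∈ ZPlus' Λ :=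
  ⟨by rw [mem_ZReal_doubled_iff, retractMap_cons_zero hp.2]; exact hp.1, by simp⟩

theorem continuous_retractMap {n : ℕ} : Continuous (retractMap (n := n)) := by
  refine continuous_pi fun i => ?_
  by_cases hi : i = 0
  · simp only [retractMap, hi, if_true]
    fun_prop
  · simp only [retractMap, hi, if_false]
    fun_prop

/-- The second coordinate of `slide t x`: it moves linearly from `x₁` to `√(x₀² + x₁²)`. -/
noncomputable def slideCoord {n : ℕ} (t : ℝ) (x : Fin (n + 2) → ℝ) : ℝ :=
  (1 - t) * x 1 + t * √(x 0 ^ 2 + x 1 ^ 2)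

/-- Moves `(x₀, x₁)` along the half circle `x₀ ≥ 0` of radius `√(x₀² + x₁²)` towards
`(0, √(x₀² + x₁²))`, keeping the other coordinates fixed. -/
noncomputable def slide {n : ℕ} (t : ℝ) (x : Fin (n + 2) → ℝ) : Fin (n + 2) → ℝ :=
  Fin.cons √(x 0 ^ 2 + x 1 ^ 2 - slideCoord t x ^ 2)
    (Fin.cons (slideCoord t x) fun i => x i.succ.succ)

theorem slideCoord_sq_le {n : ℕ} {t : ℝ} (ht₀ : 0 ≤ t) (ht₁ : t ≤ 1) (x : Fin (n + 2) → ℝ) :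
    slideCoord t x ^ 2 ≤ x 0 ^ 2 + x 1 ^ 2 := by
  have hr : |x 1| ≤ √(x 0 ^ 2 + x 1 ^ 2) := Real.abs_le_sqrt (by nlinarith [sq_nonneg (x 0)])
  obtain ⟨h₁, h₂⟩ := abs_le.1 hr
  rw [← Real.sqrt_le_sqrt_iff (by positivity), Real.sqrt_sq_eq_abs, slideCoord, abs_le]
  constructor <;> nlinarith [Real.sqrt_nonneg (x 0 ^ 2 + x 1 ^ 2)]

theorem retractMap_slide {n : ℕ} {t : ℝ} (ht₀ : 0 ≤ t) (ht₁ : t ≤ 1) (x : Fin (n + 2) → ℝ) :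
    retractMap (slide t x) = retractMap x := by
  have h := Real.sq_sqrt (sub_nonneg.2 (slideCoord_sq_le ht₀ ht₁ x))
  ext i
  cases i using Fin.cases with
  | zero => simp [retractMap, slide, h]
  | succ i => simp [retractMap, slide]

theorem slide_mem_ZPlus' {n k : ℕ} {Λ : Fin (n + 1) → Fin k → ℝ} {t : ℝ} (ht₀ : 0 ≤ t)
    (ht₁ : t ≤ 1) {x : Fin (n + 2) → ℝ} (hx : x ∈ ZPlus' Λ) : slide t x ∈ ZPlus' Λ :=
  ⟨by rw [mem_ZReal_doubled_iff, retractMap_slide ht₀ ht₁, ← mem_ZReal_doubled_iff]; exact hx.1,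
    Real.sqrt_nonneg _⟩

theorem slide_zero {n : ℕ} {x : Fin (n + 2) → ℝ} (hx : 0 ≤ x 0) : slide 0 x = x := by
  ext i
  cases i using Fin.cases with
  | zero => simp [slide, slideCoord, Real.sqrt_sq hx]
  | succ i => cases i using Fin.cases <;> simp [slide, slideCoord]

theorem slide_one {n : ℕ} (x : Fin (n + 2) → ℝ) : slide 1 x = Fin.cons 0 (retractMap x) := by
  have h : √(x 0 ^ 2 + x 1 ^ 2) ^ 2 = x 0 ^ 2 + x 1 ^ 2 := Real.sq_sqrt (by positivity)
  ext i
  cases i using Fin.cases with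
  | zero => simp [slide, slideCoord, h]
  | succ i => cases i using Fin.cases <;> simp [slide, slideCoord, retractMap]

theorem continuous_slide {n : ℕ} :
    Continuous fun p : ℝ × (Fin (n + 2) → ℝ) => slide p.1 p.2 := by
  refine continuous_pi fun i => ?_
  cases i using Fin.cases with
  | zero =>
    simp only [slide, slideCoord, Fin.cons_zero]
    fun_prop
  | succ i =>
    cases i using Fin.cases with
    | zero =>
      simp only [slide, slideCoord, Fin.cons_zero, Fin.cons_succ]
      fun_prop
    | succ i =>
      simp only [slide, Fin.cons_succ]
      fun_prop

/-- The inclusion `Z_+ → Z'_+` as a continuous map. -/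
def inclusionMap {n k : ℕ} (Λ : Fin (n + 1) → Fin k → ℝ) : C(ZPlus Λ, ZPlus' Λ) where
  toFun p := ⟨Fin.cons 0 p.1, cons_zero_mem_ZPlus' p.2⟩
  continuous_toFun := by
    refine Continuous.subtype_mk (continuous_pi fun i => ?_) _
    cases i using Fin.cases with
    | zero => simpa using continuous_const
    | succ i => exact (continuous_apply i).comp continuous_subtype_val

/-- The retraction `Z'_+ → Z_+` as a continuous map. -/
noncomputable def retraction {n k : ℕ} (Λ : Fin (n + 1) → Fin k → ℝ) :
    C(ZPlus' Λ, ZPlus Λ) where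
  toFun x := ⟨retractMap x.1, retractMap_mem_ZPlus x.2⟩
  continuous_toFun := (continuous_retractMap.comp continuous_subtype_val).subtype_mk _

theorem retraction_comp_inclusionMap {n k : ℕ} (Λ : Fin (n + 1) → Fin k → ℝ) :
    (retraction Λ).comp (inclusionMap Λ) = ContinuousMap.id _ :=
  ContinuousMap.ext fun p => Subtype.ext (retractMap_cons_zero p.2.2)

/-- The homotopy from the identity of `Z'_+` to the retraction followed by the inclusion. -/
noncomputable def slideHomotopy {n k : ℕ} (Λ : Fin (n + 1) → Fin k → ℝ) :
    (ContinuousMap.id (ZPlus' Λ)).Homotopy ((inclusionMap Λ).comp (retraction Λ)) where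
  toFun p := ⟨slide p.1 p.2.1, slide_mem_ZPlus' p.1.2.1 p.1.2.2 p.2.2⟩
  continuous_toFun := by
    have h : Continuous fun p : unitInterval × ZPlus' Λ => ((p.1 : ℝ), p.2.1) := by fun_prop
    exact (continuous_slide.comp h).subtype_mk _
  map_zero_left x := Subtype.ext (slide_zero x.2.2)
  map_one_left x := Subtype.ext (slide_one x.1)

/-- The inclusion `ι : Z_+ → Z'_+`, `ι(x_1,…,x_n) = (0, x_1, …, x_n)`, is a homotopy
equivalence, with homotopy inverse the retraction
`(x_0, x_1, x_2, …, x_n) ↦ (√(x_0² + x_1²), x_2, …, x_n)`. -/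
theorem inclusion_homotopyEquiv {n k : ℕ} (hk : 1 ≤ k)
    (Λ : Fin (n + 1) → Fin k → ℝ) (hΛ : WeaklyHyperbolic Λ) :
    ∃ E : ContinuousMap.HomotopyEquiv ↥(ZPlus Λ) ↥(ZPlus' Λ),
      (∀ p : ↥(ZPlus Λ), (E.toFun p : Fin (n + 2) → ℝ) = Fin.cons 0 p.1) ∧
      (∀ x : ↥(ZPlus' Λ), (E.invFun x : Fin (n + 1) → ℝ) = retractMap x.1) := by
  exact ⟨⟨inclusionMap Λ, retraction Λ,
    retraction_comp_inclusionMap Λ ▸ ContinuousMap.Homotopic.refl _,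
    ⟨(slideHomotopy Λ).symm⟩⟩, fun _ => rfl, fun _ => rfl⟩
end

section
/- Let n_1, n_2, n_3 be positive integers with n = n_1 + n_2 + n_3, let ω = e^{2πi/3}, and let Λ = (λ_1,…,λ_n) assign λ_i = ω^{j−1} ∈ ℂ ≅ ℝ² to every index i in the j-th block (the first n_1 indices form block 1, the next n_2 block 2, the last n_3 block 3); in particular λ_1 = 1. Then the half manifold Z_+ = Z(Λ) ∩ {x ∈ ℝ^n : x_1 ≥ 0} is homeomorphic to S^{n_2 − 1} × S^{n_3 − 1} × D^{n_1 − 1}, where D^{n_1 − 1} is the closed unit ball in ℝ^{n_1 − 1}. -/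
open scoped BigOperators

/-- The real intersection of quadrics `Z(Λ) = {x ∈ ℝ^n : ∑ λᵢ xᵢ² = 0, ∑ xᵢ² = 1}` for a
configuration `Λ` of complex numbers (identified with vectors in `ℝ²`). -/
def ZRealC {n : ℕ} (Λ : Fin n → ℂ) : Set (Fin n → ℝ) :=
  {x | (∑ i, Λ i * (((x i) ^ 2 : ℝ) : ℂ)) = 0 ∧ (∑ i, (x i) ^ 2) = 1}
/-- The configuration associated to the cyclic partition `n = n₁ + n₂ + n₃`: with
`ω = e^{2πi/3}`, each index in the `j`-th block is assigned `ω^{j-1}`. -/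
noncomputable def triConfig (n₁ n₂ n₃ : ℕ) : Fin (n₁ + n₂ + n₃) → ℂ :=
  fun i =>
    if (i : ℕ) < n₁ then 1
    else if (i : ℕ) < n₁ + n₂ then Complex.exp (2 * Real.pi * Complex.I / 3)
    else Complex.exp (2 * Real.pi * Complex.I / 3) ^ 2

/-- The third root of unity `e^{2πi/3}` in Cartesian coordinates. -/
lemma exp_two_pi_I_div_three :
    Complex.exp (2 * Real.pi * Complex.I / 3) = ⟨-1 / 2, √3 / 2⟩ := by
  have h : (2 * Real.pi * Complex.I / 3 : ℂ) = ((Real.pi - Real.pi / 3 : ℝ) : ℂ) * Complex.I := by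
    push_cast; ring
  rw [h]
  apply Complex.ext
  · rw [Complex.exp_ofReal_mul_I_re, Real.cos_pi_sub, Real.cos_pi_div_three]; norm_num
  · rw [Complex.exp_ofReal_mul_I_im, Real.sin_pi_sub, Real.sin_pi_div_three]

/-- A real combination of the three cube roots of unity vanishes with total weight one exactly when
all the weights are `1 / 3`. -/
lemma cubeRoot_combination_eq_zero_iff (A B C : ℝ) :
    ((A : ℂ) + Complex.exp (2 * Real.pi * Complex.I / 3) * B +
        Complex.exp (2 * Real.pi * Complex.I / 3) ^ 2 * C = 0 ∧ A + B + C = 1) ↔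
      A = 1 / 3 ∧ B = 1 / 3 ∧ C = 1 / 3 := by
  have h3 : √3 * √3 = 3 := Real.mul_self_sqrt (by norm_num)
  have hpos : 0 < √3 := by positivity
  rw [exp_two_pi_I_div_three, Complex.ext_iff]
  simp only [pow_two, Complex.add_re, Complex.add_im, Complex.mul_re, Complex.mul_im,
    Complex.ofReal_re, Complex.ofReal_im, Complex.zero_re, Complex.zero_im]
  constructor
  · rintro ⟨⟨hre, him⟩, hsum⟩
    have hBC : B = C := by
      have : √3 * (B - C) = 0 := by linear_combination 2 * him
      rcases mul_eq_zero.mp this with h | h <;> linarith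
    subst hBC
    have : A - B = 0 := by linear_combination hre + B / 4 * h3
    exact ⟨by linarith, by linarith, by linarith⟩
  · rintro ⟨rfl, rfl, rfl⟩
    refine ⟨⟨?_, ?_⟩, ?_⟩
    · linear_combination -(1 / 12) * h3
    · ring
    · norm_num

/-- `Z(Λ)` for the cyclic partition is a product of three spheres of squared radius `1 / 3`. -/
lemma mem_ZRealC_triConfig_iff {n₁ n₂ n₃ : ℕ} (x : Fin (n₁ + n₂ + n₃) → ℝ) :
    x ∈ ZRealC (triConfig n₁ n₂ n₃) ↔
      ∑ i : Fin n₁, x (Fin.castAdd n₃ (Fin.castAdd n₂ i)) ^ 2 = 1 / 3 ∧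
      ∑ i : Fin n₂, x (Fin.castAdd n₃ (Fin.natAdd n₁ i)) ^ 2 = 1 / 3 ∧
      ∑ i : Fin n₃, x (Fin.natAdd (n₁ + n₂) i) ^ 2 = 1 / 3 := by
  rw [← cubeRoot_combination_eq_zero_iff]
  simp only [ZRealC, Set.mem_ofPred_eq, Fin.sum_univ_add]
  have h1 (i : Fin n₁) : triConfig n₁ n₂ n₃ (Fin.castAdd n₃ (Fin.castAdd n₂ i)) = 1 := by
    simp [triConfig]
  have h2 (i : Fin n₂) : triConfig n₁ n₂ n₃ (Fin.castAdd n₃ (Fin.natAdd n₁ i)) =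
      Complex.exp (2 * Real.pi * Complex.I / 3) := by
    simp [triConfig]
  have h3 (i : Fin n₃) : triConfig n₁ n₂ n₃ (Fin.natAdd (n₁ + n₂) i) =
      Complex.exp (2 * Real.pi * Complex.I / 3) ^ 2 := by
    simp [triConfig, add_assoc]
  simp only [h1, h2, h3, one_mul, ← Finset.mul_sum, Complex.ofReal_sum]

lemma mem_sphere_zero_one_iff_sum_sq {n : ℕ} (v : EuclideanSpace ℝ (Fin n)) :
    v ∈ Metric.sphere (0 : EuclideanSpace ℝ (Fin n)) 1 ↔ ∑ i, v i ^ 2 = 1 := by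
  rw [EuclideanSpace.sphere_zero_eq 1 zero_le_one]; simp

lemma mem_closedBall_zero_one_iff_sum_sq {n : ℕ} (v : EuclideanSpace ℝ (Fin n)) :
    v ∈ Metric.closedBall (0 : EuclideanSpace ℝ (Fin n)) 1 ↔ ∑ i, v i ^ 2 ≤ 1 := by
  rw [EuclideanSpace.closedBall_zero_eq 1 zero_le_one]; simp

/-- The point of `ℝ^{(m+1)+p+q}` whose blocks are `1 / √3` times the point of the upper hemisphere
over `d`, times `y`, and times `z`. -/
noncomputable def hemisphereSpheresPoint {m p q : ℕ} (y : Fin p → ℝ) (z : Fin q → ℝ)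
    (d : Fin m → ℝ) : Fin (m + 1 + p + q) → ℝ :=
  fun i => Fin.append (Fin.append (Fin.cons √(1 - ∑ j, d j ^ 2) d) y) z i / √3

lemma hemisphereSpheresPoint_zero {m p q : ℕ} (y : Fin p → ℝ) (z : Fin q → ℝ) (d : Fin m → ℝ) :
    hemisphereSpheresPoint y z d (Fin.castAdd q (Fin.castAdd p 0)) =
      √(1 - ∑ j, d j ^ 2) / √3 := by
  simp only [hemisphereSpheresPoint, Fin.append_left, Fin.cons_zero]

lemma hemisphereSpheresPoint_succ {m p q : ℕ} (y : Fin p → ℝ) (z : Fin q → ℝ) (d : Fin m → ℝ)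
    (j : Fin m) :
    hemisphereSpheresPoint y z d (Fin.castAdd q (Fin.castAdd p j.succ)) = d j / √3 := by
  simp only [hemisphereSpheresPoint, Fin.append_left, Fin.cons_succ]

lemma hemisphereSpheresPoint_middle {m p q : ℕ} (y : Fin p → ℝ) (z : Fin q → ℝ) (d : Fin m → ℝ)
    (j : Fin p) :
    hemisphereSpheresPoint y z d (Fin.castAdd q (Fin.natAdd (m + 1) j)) = y j / √3 := by
  simp only [hemisphereSpheresPoint, Fin.append_left, Fin.append_right]

lemma hemisphereSpheresPoint_last {m p q : ℕ} (y : Fin p → ℝ) (z : Fin q → ℝ) (d : Fin m → ℝ)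
    (j : Fin q) :
    hemisphereSpheresPoint y z d (Fin.natAdd (m + 1 + p) j) = z j / √3 := by
  simp only [hemisphereSpheresPoint, Fin.append_right]

lemma continuous_hemisphereSpheresPoint {m p q : ℕ} :
    Continuous fun t : (Fin p → ℝ) × (Fin q → ℝ) × (Fin m → ℝ) =>
      hemisphereSpheresPoint t.1 t.2.1 t.2.2 := by
  refine continuous_pi fun i => ?_
  refine Fin.addCases (fun i => ?_) (fun i => ?_) i
  · refine Fin.addCases (fun i => ?_) (fun i => ?_) i
    · refine Fin.cases ?_ (fun i => ?_) i
      · simp only [hemisphereSpheresPoint_zero]; fun_prop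
      · simp only [hemisphereSpheresPoint_succ]; fun_prop
    · simp only [hemisphereSpheresPoint_middle]; fun_prop
  · simp only [hemisphereSpheresPoint_last]; fun_prop

lemma hemisphereSpheresPoint_mem_ZRealC {m p q : ℕ} {y : Fin p → ℝ} {z : Fin q → ℝ}
    {d : Fin m → ℝ} (hy : ∑ j, y j ^ 2 = 1) (hz : ∑ j, z j ^ 2 = 1) (hd : ∑ j, d j ^ 2 ≤ 1) :
    hemisphereSpheresPoint y z d ∈ ZRealC (triConfig (m + 1) p q) := by
  have h3 : √3 ^ 2 = 3 := Real.sq_sqrt (by norm_num)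
  rw [mem_ZRealC_triConfig_iff]
  simp only [Fin.sum_univ_succ, hemisphereSpheresPoint_zero, hemisphereSpheresPoint_succ,
    hemisphereSpheresPoint_middle, hemisphereSpheresPoint_last, div_pow, h3, ← Finset.sum_div,
    Real.sq_sqrt (sub_nonneg.mpr hd), hy, hz, and_self, and_true]
  ring

/-- The half manifold with first block of size `m + 1` as a product of two spheres and a ball. -/
noncomputable def halfTriHomeomorph (m p q : ℕ) :
    {x ∈ ZRealC (triConfig (m + 1) p q) | 0 ≤ x (Fin.castAdd q (Fin.castAdd p 0))} ≃ₜ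
      (Metric.sphere (0 : EuclideanSpace ℝ (Fin p)) 1 ×
        Metric.sphere (0 : EuclideanSpace ℝ (Fin q)) 1 ×
        Metric.closedBall (0 : EuclideanSpace ℝ (Fin m)) 1) where
  toFun x :=
    ⟨⟨WithLp.toLp 2 fun j => √3 * x.1 (Fin.castAdd q (Fin.natAdd (m + 1) j)), by
        have h := ((mem_ZRealC_triConfig_iff _).mp x.2.1).2.1
        rw [mem_sphere_zero_one_iff_sum_sq]
        simp [mul_pow, ← Finset.mul_sum, h]⟩,
      ⟨WithLp.toLp 2 fun j => √3 * x.1 (Fin.natAdd (m + 1 + p) j), by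
        have h := ((mem_ZRealC_triConfig_iff _).mp x.2.1).2.2
        rw [mem_sphere_zero_one_iff_sum_sq]
        simp [mul_pow, ← Finset.mul_sum, h]⟩,
      ⟨WithLp.toLp 2 fun j => √3 * x.1 (Fin.castAdd q (Fin.castAdd p j.succ)), by
        have h := ((mem_ZRealC_triConfig_iff _).mp x.2.1).1
        rw [Fin.sum_univ_succ] at h
        simp only [mem_closedBall_zero_one_iff_sum_sq, mul_pow, ← Finset.mul_sum,
          Real.sq_sqrt (show (0 : ℝ) ≤ 3 by norm_num)]
        nlinarith [sq_nonneg (x.1 (Fin.castAdd q (Fin.castAdd p 0)))]⟩⟩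
  invFun t :=
    ⟨hemisphereSpheresPoint t.1.1 t.2.1.1 t.2.2.1,
      hemisphereSpheresPoint_mem_ZRealC ((mem_sphere_zero_one_iff_sum_sq _).mp t.1.2)
        ((mem_sphere_zero_one_iff_sum_sq _).mp t.2.1.2)
        ((mem_closedBall_zero_one_iff_sum_sq _).mp t.2.2.2),
      by rw [hemisphereSpheresPoint_zero]; positivity⟩
  left_inv := by
    rintro ⟨x, hx, hx0⟩
    have h := ((mem_ZRealC_triConfig_iff _).mp hx).1
    rw [Fin.sum_univ_succ] at h
    refine Subtype.ext (funext fun i => ?_)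
    refine Fin.addCases (fun i => ?_) (fun i => ?_) i
    · refine Fin.addCases (fun i => ?_) (fun i => ?_) i
      · refine Fin.cases ?_ (fun i => ?_) i
        · simp only [hemisphereSpheresPoint_zero, mul_pow, ← Finset.mul_sum,
            Real.sq_sqrt (show (0 : ℝ) ≤ 3 by norm_num)]
          rw [← Real.sqrt_div' _ (by norm_num), ← Real.sqrt_sq hx0]
          congr 1
          linarith
        · simp only [hemisphereSpheresPoint_succ]; field_simp
      · simp only [hemisphereSpheresPoint_middle]; field_simp
    · simp only [hemisphereSpheresPoint_last]; field_simp
  right_inv := by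
    rintro ⟨⟨y, hy⟩, ⟨z, hz⟩, ⟨d, hd⟩⟩
    refine Prod.ext (Subtype.ext ?_) (Prod.ext (Subtype.ext ?_) (Subtype.ext ?_)) <;>
      ext j <;>
      simp only [hemisphereSpheresPoint_succ, hemisphereSpheresPoint_middle,
        hemisphereSpheresPoint_last] <;>
      field_simp
  continuous_toFun := by
    have hcoord (i : Fin (m + 1 + p + q)) : Continuous fun x : {x ∈ ZRealC (triConfig (m + 1) p q) |
        0 ≤ x (Fin.castAdd q (Fin.castAdd p 0))} => x.1 i :=
      (continuous_apply i).comp continuous_subtype_val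
    refine Continuous.prodMk ?_ (Continuous.prodMk ?_ ?_) <;>
      exact Continuous.subtype_mk ((PiLp.continuous_toLp 2 _).comp (continuous_pi fun _ =>
        continuous_const.mul (hcoord _))) _
  continuous_invFun := by
    refine Continuous.subtype_mk (continuous_hemisphereSpheresPoint.comp
      (f := fun t : Metric.sphere (0 : EuclideanSpace ℝ (Fin p)) 1 ×
        Metric.sphere (0 : EuclideanSpace ℝ (Fin q)) 1 ×
        Metric.closedBall (0 : EuclideanSpace ℝ (Fin m)) 1 =>
          (WithLp.ofLp t.1.1, WithLp.ofLp t.2.1.1, WithLp.ofLp t.2.2.1)) ?_) _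
    fun_prop

/-- Part (a) of the description of the half manifolds: for the cyclic partition
`n = n₁ + n₂ + n₃` (with `λ₁ = 1`), the half manifold `Z₊ = Z(Λ) ∩ {x₁ ≥ 0}` is
homeomorphic to `S^{n₂−1} × S^{n₃−1} × D^{n₁−1}`. -/
theorem ZPlus_triple_product {n₁ n₂ n₃ : ℕ}
    (h₁ : 0 < n₁) (h₂ : 0 < n₂) (h₃ : 0 < n₃) :
    Nonempty (↥{x ∈ ZRealC (triConfig n₁ n₂ n₃) | 0 ≤ x ⟨0, by omega⟩} ≃ₜ
      (Metric.sphere (0 : EuclideanSpace ℝ (Fin n₂)) 1 ×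
        Metric.sphere (0 : EuclideanSpace ℝ (Fin n₃)) 1 ×
        Metric.closedBall (0 : EuclideanSpace ℝ (Fin (n₁ - 1))) 1)) := by
  obtain ⟨m, rfl⟩ : ∃ m, n₁ = m + 1 := ⟨n₁ - 1, by omega⟩
  exact ⟨halfTriHomeomorph m n₂ n₃⟩
end
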